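/- Let A : ℤ³ → ℂ satisfy A(n,r,m) = 0 unless n > 0 and 4nm > r², and suppose the series F(τ,z,τ') = Σ_{n,r,m∈ℤ} A(n,r,m)·e(nτ+rz+mτ') converges absolutely at every point of ℍ₂. Define F↓(τ,z,τ') = F(τ,2z,2τ')·F(τ,z,τ'/2)·F(τ,z,(τ'+1)/2). Suppose B : ℤ³ → ℂ is such that F↓(τ,z,τ') = Σ_{n,r,m∈ℤ} B(n,r,m)·e(nτ+rz+mτ') with absolute convergence at every point of ℍ₂. Then for every r ∈ ℤ: B(4,r,3) = − Σ_{r₁,r₂,r₃∈ℤ, 2r₁+r₂+r₃=r} ( A(2,r₁,1)·A(1,r₂,1)·A(1,r₃,1) + A(1,r₁,1)·A(2,r₂,1)·A(1,r₃,1) + A(1,r₁,1)·A(1,r₂,1)·A(2,r₃,1) ) (a finite sum, by the support condition on A). -/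

import Mathlib

noncomputable section
open Complex BigOperators

namespace HeimMurase

/-- `e(u) = exp(2 π i u)`. -/
def e (u : ℂ) : ℂ := Complex.exp (2 * Real.pi * Complex.I * u)

/-- The Siegel upper half space of degree 2, in the coordinates `(τ, z, τ')` of a symmetric
`2×2` complex matrix `(τ z; z τ')`. -/
def H2 : Set (ℂ × ℂ × ℂ) :=
  {t | 0 < t.1.im ∧ 0 < t.2.2.im ∧ (t.2.1.im) ^ 2 < t.1.im * t.2.2.im}

/-- The Fourier series `F(τ,z,τ') = Σ_{n,r,m} A(n,r,m) e(nτ + rz + mτ')`. -/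
def FS (A : ℤ × ℤ × ℤ → ℂ) (τ z τ' : ℂ) : ℂ :=
  ∑' q : ℤ × ℤ × ℤ, A q * e ((q.1 : ℂ) * τ + (q.2.1 : ℂ) * z + (q.2.2 : ℂ) * τ')

section FourierUniqueness

open MeasureTheory

/-- The normalised Haar measure on `ℝ / ℤ`, the convention of `UnitAddTorus.mFourierLp`. -/
local instance : MeasureSpace UnitAddCircle := ⟨AddCircle.haarAddCircle⟩

local instance : IsProbabilityMeasure (volume : Measure UnitAddCircle) :=
  inferInstanceAs (IsProbabilityMeasure AddCircle.haarAddCircle)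

/-- The `k`-th Fourier coefficient as a continuous linear functional on `C(UnitAddTorus d, ℂ)`. -/
lemma exists_mFourierCoeff_clm {d : Type*} [Fintype d] [DecidableEq d] (k : d → ℤ) :
    ∃ L : C(UnitAddTorus d, ℂ) →L[ℂ] ℂ,
      ∀ n, L (UnitAddTorus.mFourier n) = if n = k then 1 else 0 := by
  refine ⟨(innerSL ℂ (UnitAddTorus.mFourierLp 2 k)).comp
    (ContinuousMap.toLp (E := ℂ) 2 volume ℂ), fun n => ?_⟩
  have h := orthonormal_iff_ite.mp (UnitAddTorus.orthonormal_mFourier (d := d)) k n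
  simpa [eq_comm] using h

end FourierUniqueness

lemma e_add (u v : ℂ) : e (u + v) = e u * e v := by
  simp only [e, mul_add, Complex.exp_add]

lemma e_intCast (m : ℤ) : e m = 1 := by
  rw [e, mul_comm]
  exact Complex.exp_int_mul_two_pi_mul_I m

lemma e_ne_zero (u : ℂ) : e u ≠ 0 := Complex.exp_ne_zero _

lemma norm_e_ofReal (x : ℝ) : ‖e x‖ = 1 := by
  rw [e, Complex.norm_exp]
  simp

lemma mFourier_coe {d : Type*} [Fintype d] (n : d → ℤ) (x : d → ℝ) :
    UnitAddTorus.mFourier n (fun i => (x i : UnitAddCircle))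
      = e ((∑ i, (n i : ℝ) * x i : ℝ) : ℂ) := by
  rw [e, UnitAddTorus.mFourier]
  simp only [ContinuousMap.coe_mk, fourier_coe_apply]
  rw [← Complex.exp_sum]
  congr 1
  push_cast
  rw [Finset.mul_sum]
  exact Finset.sum_congr rfl fun i _ => by ring

lemma summable_smul_mFourier {d J : Type*} [Fintype d] {c : J → ℂ} (N : J → d → ℤ)
    (hc : Summable c) : Summable fun j => c j • UnitAddTorus.mFourier (N j) :=
  Summable.of_norm (by simpa [norm_smul, UnitAddTorus.mFourier_norm] using hc.norm)

/-- Two absolutely convergent trigonometric series, with frequencies possibly repeated, which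
define the same function on `ℝ^d` have the same total coefficient at each frequency. -/
lemma tsum_coeff_eq_of_trig_series_eq {d J J' : Type*} [Fintype d] [DecidableEq d]
    {c : J → ℂ} {c' : J' → ℂ} (N : J → d → ℤ) (N' : J' → d → ℤ)
    (hc : Summable c) (hc' : Summable c')
    (h : ∀ x : d → ℝ, ∑' j, c j * e ((∑ i, (N j i : ℝ) * x i : ℝ) : ℂ)
      = ∑' j, c' j * e ((∑ i, (N' j i : ℝ) * x i : ℝ) : ℂ)) (k : d → ℤ) :
    ∑' j, (if N j = k then c j else 0) = ∑' j, if N' j = k then c' j else 0 := by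
  obtain ⟨L, hL⟩ := exists_mFourierCoeff_clm k
  have hs := summable_smul_mFourier N hc
  have hs' := summable_smul_mFourier N' hc'
  have heq : ∑' j, c j • UnitAddTorus.mFourier (N j)
      = ∑' j, c' j • UnitAddTorus.mFourier (N' j) := by
    ext y
    obtain ⟨x, rfl⟩ : ∃ x : d → ℝ, (fun i => (x i : UnitAddCircle)) = y := by
      choose x hx using fun i => QuotientAddGroup.mk_surjective (y i)
      exact ⟨x, funext hx⟩
    rw [← ContinuousMap.tsum_apply hs, ← ContinuousMap.tsum_apply hs']
    simpa only [ContinuousMap.smul_apply, smul_eq_mul, mFourier_coe] using h x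
  have hmap := congrArg L heq
  rw [L.map_tsum hs, L.map_tsum hs'] at hmap
  simpa only [map_smul, hL, smul_eq_mul, mul_ite, mul_one, mul_zero] using hmap

/-- The term of index `q` of the Fourier series with coefficients `A`, at the point `p`. -/
def fourierTerm (A : ℤ × ℤ × ℤ → ℂ) (p : ℂ × ℂ × ℂ) (q : ℤ × ℤ × ℤ) : ℂ :=
  A q * e ((q.1 : ℂ) * p.1 + (q.2.1 : ℂ) * p.2.1 + (q.2.2 : ℂ) * p.2.2)

lemma fourierTerm_add_ofReal (A : ℤ × ℤ × ℤ → ℂ) (p : ℂ × ℂ × ℂ) (x y z : ℝ) (q : ℤ × ℤ × ℤ) :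
    A q * e ((q.1 : ℂ) * (p.1 + x) + (q.2.1 : ℂ) * (p.2.1 + y) + (q.2.2 : ℂ) * (p.2.2 + z))
      = fourierTerm A p q * e ((q.1 * x + q.2.1 * y + q.2.2 * z : ℝ) : ℂ) := by
  rw [fourierTerm, mul_assoc, ← e_add]
  congr 2
  push_cast
  ring

lemma FS_add_ofReal (A : ℤ × ℤ × ℤ → ℂ) (p : ℂ × ℂ × ℂ) (x y z : ℝ) :
    FS A (p.1 + x) (p.2.1 + y) (p.2.2 + z)
      = ∑' q, fourierTerm A p q * e ((q.1 * x + q.2.1 * y + q.2.2 * z : ℝ) : ℂ) :=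
  tsum_congr (fourierTerm_add_ofReal A p x y z)

lemma tsum_mul_tsum_mul_tsum {J : Type*} {f g h : J → ℂ} (hf : Summable f) (hg : Summable g)
    (hh : Summable h) :
    (∑' j, f j) * (∑' j, g j) * (∑' j, h j)
      = ∑' Q : (J × J) × J, f Q.1.1 * g Q.1.2 * h Q.2 := by
  rw [tsum_mul_tsum_of_summable_norm hf.norm hg.norm]
  exact tsum_mul_tsum_of_summable_norm (f := fun P : J × J => f P.1 * g P.2)
    (summable_mul_of_summable_norm hf.norm hg.norm).norm hh.norm

lemma summable_mul_e_ofReal {J : Type*} {f : J → ℂ} (hf : Summable f) (y : J → ℝ) :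
    Summable fun j => f j * e (y j) :=
  Summable.of_norm (by simpa only [norm_mul, norm_e_ofReal, mul_one] using hf.norm)

lemma product_of_terms_freq_eq {A : ℤ × ℤ × ℤ → ℂ} (q₁ q₂ q₃ : ℤ × ℤ × ℤ)
    (h₁ : q₁.1 + q₂.1 + q₃.1 = 4) (h₃ : 4 * q₁.2.2 + q₂.2.2 + q₃.2.2 = 6)
    (hq₃ : q₃.2.2 = 1) :
    fourierTerm A (I, 0, 4 * I) q₁ * fourierTerm A (I, 0, I) q₂ *
        fourierTerm A (I, 0, I + 1 / 2) q₃
      = -(A q₁ * A q₂ * A q₃) * e (10 * I) := by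
  have h₁' : (q₁.1 : ℂ) + q₂.1 + q₃.1 = 4 := mod_cast h₁
  have h₃' : 4 * (q₁.2.2 : ℂ) + q₂.2.2 + q₃.2.2 = 6 := mod_cast h₃
  have hq : (q₃.2.2 : ℂ) = 1 := mod_cast hq₃
  have he : e (1 / 2) = -1 := by
    rw [e, ← Complex.exp_pi_mul_I]
    congr 1
    ring
  have hsum : ((q₁.1 : ℂ) * I + q₁.2.1 * 0 + q₁.2.2 * (4 * I))
      + ((q₂.1 : ℂ) * I + q₂.2.1 * 0 + q₂.2.2 * I)
      + ((q₃.1 : ℂ) * I + q₃.2.1 * 0 + q₃.2.2 * (I + 1 / 2)) = 10 * I + 1 / 2 := by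
    linear_combination I * h₁' + I * h₃' + (1 / 2) * hq
  have hprod := congrArg e hsum
  simp only [e_add _ (1 / 2), he] at hprod
  rw [e_add, e_add] at hprod
  simp only [fourierTerm]
  linear_combination (A q₁ * A q₂ * A q₃) * hprod

/-- The index triples contributing to `B (4, r, 3)`: `n = 2` in the position `i`, and `n = 1` in
the two others. -/
def contributingTriple {r : ℤ}
    (v : {u : ℤ × ℤ × ℤ // 2 * u.1 + u.2.1 + u.2.2 = r} × Fin 3) :
    ((ℤ × ℤ × ℤ) × (ℤ × ℤ × ℤ)) × (ℤ × ℤ × ℤ) :=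
  (((if v.2 = 0 then 2 else 1, v.1.1.1, 1), (if v.2 = 1 then 2 else 1, v.1.1.2.1, 1)),
    (if v.2 = 2 then 2 else 1, v.1.1.2.2, 1))

lemma contributingTriple_injective (r : ℤ) :
    Function.Injective (contributingTriple (r := r)) := by
  rintro ⟨⟨⟨a, b, c⟩, hu⟩, i⟩ ⟨⟨⟨a', b', c'⟩, hu'⟩, i'⟩ h
  simp only [contributingTriple, Prod.mk.injEq] at h
  obtain ⟨⟨⟨h₁, rfl, -⟩, ⟨h₂, rfl, -⟩⟩, ⟨h₃, rfl, -⟩⟩ := h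
  fin_cases i <;> fin_cases i' <;> simp_all

/-- The frequency of a triple of indices in the product defining `F↓`, in the variables
`(τ, z, τ' / 2)`. -/
def tripleFreq (Q : ((ℤ × ℤ × ℤ) × (ℤ × ℤ × ℤ)) × (ℤ × ℤ × ℤ)) : Fin 3 → ℤ :=
  ![Q.1.1.1 + Q.1.2.1 + Q.2.1, 2 * Q.1.1.2.1 + Q.1.2.2.1 + Q.2.2.1,
    4 * Q.1.1.2.2 + Q.1.2.2.2 + Q.2.2.2]

lemma vec3_eq_iff {a b c a' b' c' : ℤ} :
    (![a, b, c] : Fin 3 → ℤ) = ![a', b', c'] ↔ a = a' ∧ b = b' ∧ c = c' := by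
  simp [funext_iff, Fin.forall_fin_succ]

lemma mem_range_contributingTriple {r : ℤ} {q₁ q₂ q₃ : ℤ × ℤ × ℤ}
    (hQ : tripleFreq ((q₁, q₂), q₃) = ![4, r, 6])
    (hn₁ : 0 < q₁.1) (hn₂ : 0 < q₂.1) (hn₃ : 0 < q₃.1)
    (hm₁ : 0 < q₁.2.2) (hm₂ : 0 < q₂.2.2) (hm₃ : 0 < q₃.2.2) :
    ((q₁, q₂), q₃) ∈ Set.range (contributingTriple (r := r)) := by
  obtain ⟨n₁, r₁, m₁⟩ := q₁
  obtain ⟨n₂, r₂, m₂⟩ := q₂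
  obtain ⟨n₃, r₃, m₃⟩ := q₃
  rw [tripleFreq, vec3_eq_iff] at hQ
  dsimp only at *
  obtain ⟨h₁, h₂, h₃⟩ := hQ
  obtain rfl : m₁ = 1 := by omega
  obtain rfl : m₂ = 1 := by omega
  obtain rfl : m₃ = 1 := by omega
  rcases (by omega : (n₁ = 2 ∧ n₂ = 1 ∧ n₃ = 1) ∨ (n₁ = 1 ∧ n₂ = 2 ∧ n₃ = 1) ∨
    (n₁ = 1 ∧ n₂ = 1 ∧ n₃ = 2)) with ⟨rfl, rfl, rfl⟩ | ⟨rfl, rfl, rfl⟩ | ⟨rfl, rfl, rfl⟩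
  · exact ⟨(⟨(r₁, r₂, r₃), h₂⟩, 0), by simp [contributingTriple]⟩
  · exact ⟨(⟨(r₁, r₂, r₃), h₂⟩, 1), by simp [contributingTriple]⟩
  · exact ⟨(⟨(r₁, r₂, r₃), h₂⟩, 2), by simp [contributingTriple]⟩

lemma tripleFreq_contributingTriple {r : ℤ}
    (v : {u : ℤ × ℤ × ℤ // 2 * u.1 + u.2.1 + u.2.2 = r} × Fin 3) :
    tripleFreq (contributingTriple v) = ![4, r, 6] := by
  obtain ⟨⟨⟨a, b, c⟩, hu⟩, i⟩ := v
  rw [tripleFreq, vec3_eq_iff]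
  refine ⟨?_, hu, rfl⟩
  fin_cases i <;> simp [contributingTriple]


/-- **Lemma 8.2 of Heim–Murase, second formula.** If `F` has Fourier coefficients `A(n,r,m)`
supported on `n > 0`, `4nm > r²`, and `F↓(τ,z,τ') = F(τ,2z,2τ')·F(τ,z,τ'/2)·F(τ,z,(τ'+1)/2)`
has Fourier coefficients `B`, then
`B(4,r,3) = −Σ_{2r₁+r₂+r₃=r} (A(2,r₁,1)A(1,r₂,1)A(1,r₃,1) + A(1,r₁,1)A(2,r₂,1)A(1,r₃,1)
+ A(1,r₁,1)A(1,r₂,1)A(2,r₃,1))`. -/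
theorem fourier_coeff_down
    (A : ℤ × ℤ × ℤ → ℂ)
    (hsupp : ∀ q : ℤ × ℤ × ℤ, ¬ (0 < q.1 ∧ q.2.1 ^ 2 < 4 * q.1 * q.2.2) → A q = 0)
    (hAconv : ∀ t ∈ H2, Summable (fun q : ℤ × ℤ × ℤ =>
      A q * e ((q.1 : ℂ) * t.1 + (q.2.1 : ℂ) * t.2.1 + (q.2.2 : ℂ) * t.2.2)))
    (B : ℤ × ℤ × ℤ → ℂ)
    (hBconv : ∀ t ∈ H2, Summable (fun q : ℤ × ℤ × ℤ =>
      B q * e ((q.1 : ℂ) * t.1 + (q.2.1 : ℂ) * t.2.1 + (q.2.2 : ℂ) * t.2.2)))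
    (hB : ∀ t ∈ H2,
      FS A t.1 (2 * t.2.1) (2 * t.2.2) * FS A t.1 t.2.1 (t.2.2 / 2) *
          FS A t.1 t.2.1 ((t.2.2 + 1) / 2)
        = ∑' q : ℤ × ℤ × ℤ,
            B q * e ((q.1 : ℂ) * t.1 + (q.2.1 : ℂ) * t.2.1 + (q.2.2 : ℂ) * t.2.2))
    (r : ℤ) :
    B (4, r, 3)
      = - ∑' u : {u : ℤ × ℤ × ℤ // 2 * u.1 + u.2.1 + u.2.2 = r},
          (A (2, u.1.1, 1) * A (1, u.1.2.1, 1) * A (1, u.1.2.2, 1) +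
           A (1, u.1.1, 1) * A (2, u.1.2.1, 1) * A (1, u.1.2.2, 1) +
           A (1, u.1.1, 1) * A (1, u.1.2.1, 1) * A (2, u.1.2.2, 1)) := by
  have hsA : ∀ p ∈ H2, Summable (fourierTerm A p) := hAconv
  set a₁ := fourierTerm A (I, 0, 4 * I) with ha₁
  set a₂ := fourierTerm A (I, 0, I) with ha₂
  set a₃ := fourierTerm A (I, 0, I + 1 / 2) with ha₃
  set b := fourierTerm B (I, 0, 2 * I) with hb
  have s₁ : Summable a₁ := hsA _ (by simp [H2])
  have s₂ : Summable a₂ := hsA _ (by simp [H2])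
  have s₃ : Summable a₃ := hsA _ (by simp [H2])
  have sb : Summable b := hBconv _ (by simp [H2])
  set c : ((ℤ × ℤ × ℤ) × (ℤ × ℤ × ℤ)) × (ℤ × ℤ × ℤ) → ℂ :=
    fun Q => a₁ Q.1.1 * a₂ Q.1.2 * a₃ Q.2 with hc
  have sc : Summable c := summable_mul_of_summable_norm
    (f := fun P : (ℤ × ℤ × ℤ) × (ℤ × ℤ × ℤ) => a₁ P.1 * a₂ P.2)
    (summable_mul_of_summable_norm s₁.norm s₂.norm).norm s₃.norm
  have hseries : ∀ x : Fin 3 → ℝ,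
      ∑' Q, c Q * e ((∑ i, (tripleFreq Q i : ℝ) * x i : ℝ) : ℂ)
        = ∑' q : ℤ × ℤ × ℤ, b q *
          e ((∑ i, ((![q.1, q.2.1, 2 * q.2.2] : Fin 3 → ℤ) i : ℝ) * x i : ℝ) : ℂ) := by
    intro x
    have h := (hB (I + (x 0 : ℝ), 0 + (x 1 : ℝ), 2 * I + (2 * x 2 : ℝ)) (by simp [H2])).trans
      (FS_add_ofReal B (I, 0, 2 * I) (x 0) (x 1) (2 * x 2))
    have e₁ := FS_add_ofReal A (I, 0, 4 * I) (x 0) (2 * x 1) (4 * x 2)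
    have e₂ := FS_add_ofReal A (I, 0, I) (x 0) (x 1) (x 2)
    have e₃ := FS_add_ofReal A (I, 0, I + 1 / 2) (x 0) (x 1) (x 2)
    dsimp only at h e₁ e₂ e₃
    rw [show (2 : ℂ) * (0 + (x 1 : ℝ)) = 0 + ((2 * x 1 : ℝ) : ℂ) by push_cast; ring,
      show (2 : ℂ) * (2 * I + ((2 * x 2 : ℝ) : ℂ)) = 4 * I + ((4 * x 2 : ℝ) : ℂ) by
        push_cast; ring,
      show (2 * I + ((2 * x 2 : ℝ) : ℂ)) / 2 = I + (x 2 : ℝ) by push_cast; ring,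
      show (2 * I + ((2 * x 2 : ℝ) : ℂ) + 1) / 2 = I + 1 / 2 + (x 2 : ℝ) by push_cast; ring,
      e₁, e₂, e₃, tsum_mul_tsum_mul_tsum (summable_mul_e_ofReal s₁ _) (summable_mul_e_ofReal s₂ _)
        (summable_mul_e_ofReal s₃ _)] at h
    refine Eq.trans (tsum_congr fun Q => ?_) (h.trans (tsum_congr fun q => ?_))
    · have : ∀ u v w u' v' w' : ℂ, u * u' * (v * v') * (w * w') = u * v * w * (u' * v' * w') :=
        fun _ _ _ _ _ _ => by ring
      rw [this, ← e_add, ← e_add]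
      simp only [hc, tripleFreq, Fin.sum_univ_three]
      congr 2
      simp
      ring
    · rw [← hb]
      congr 2
      simp [Fin.sum_univ_three]
      ring
  have hcoeff := tsum_coeff_eq_of_trig_series_eq _ _ sc sb hseries ![4, r, 6]
  have hright : ∑' q : ℤ × ℤ × ℤ, (if ![q.1, q.2.1, 2 * q.2.2] = (![4, r, 6] : Fin 3 → ℤ)
      then b q else 0) = B (4, r, 3) * e (10 * I) := by
    rw [tsum_eq_single (4, r, 3)]
    · rw [if_pos (by simp), hb, fourierTerm]
      congr 2
      push_cast
      ring
    · rintro ⟨n, s, m⟩ hq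
      refine if_neg fun h => hq ?_
      rw [vec3_eq_iff] at h
      obtain ⟨rfl, rfl, h⟩ := h
      obtain rfl : m = 3 := by dsimp only at h; omega
      rfl
  have hpos : ∀ q, A q ≠ 0 → 0 < q.1 ∧ 0 < q.2.2 := by
    intro q hq
    obtain ⟨hn, hd⟩ := not_not.mp (mt (hsupp q) hq)
    exact ⟨hn, pos_of_mul_pos_right ((sq_nonneg _).trans_lt hd) (by positivity)⟩
  set g : ((ℤ × ℤ × ℤ) × (ℤ × ℤ × ℤ)) × (ℤ × ℤ × ℤ) → ℂ :=
    fun Q => if tripleFreq Q = ![4, r, 6] then c Q else 0 with hg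
  have hgsupp : Function.support g ⊆ Set.range (contributingTriple (r := r)) := by
    rintro ⟨⟨q₁, q₂⟩, q₃⟩ hQ
    obtain ⟨hQ, hcQ⟩ := ite_ne_right_iff.mp (Function.mem_support.mp hQ)
    simp only [hc, ha₁, ha₂, ha₃, fourierTerm, ne_eq, mul_eq_zero, not_or] at hcQ
    obtain ⟨⟨⟨h₁, -⟩, h₂, -⟩, h₃, -⟩ := hcQ
    exact mem_range_contributingTriple hQ (hpos _ h₁).1 (hpos _ h₂).1 (hpos _ h₃).1
      (hpos _ h₁).2 (hpos _ h₂).2 (hpos _ h₃).2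
  have sg : Summable g := by
    refine (sc.indicator {Q | tripleFreq Q = ![4, r, 6]}).congr fun Q => ?_
    simp only [hg, Set.indicator_apply, Set.mem_ofPred_eq]
  have hgv : ∀ v, g (contributingTriple (r := r) v)
      = -(A (contributingTriple v).1.1 * A (contributingTriple v).1.2 *
          A (contributingTriple v).2) * e (10 * I) := by
    intro v
    have hv := tripleFreq_contributingTriple v
    rw [hg]
    dsimp only
    rw [if_pos hv]
    rw [tripleFreq, vec3_eq_iff] at hv
    exact product_of_terms_freq_eq _ _ _ hv.1 hv.2.2 rfl
  rw [hright, ← (contributingTriple_injective r).tsum_eq hgsupp] at hcoeff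
  have sgc : Summable fun v => g (contributingTriple (r := r) v) :=
    sg.comp_injective (contributingTriple_injective r)
  rw [sgc.tsum_prod] at hcoeff
  refine mul_right_cancel₀ (e_ne_zero (10 * I)) (hcoeff.symm.trans ?_)
  rw [← tsum_neg, ← tsum_mul_right]
  refine tsum_congr fun u => ?_
  simp only [tsum_fintype, Fin.sum_univ_three, hgv]
  simp [contributingTriple]
  ring


end HeimMurase
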